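/- Assume Schanuel's Conjecture. In the setup described, there exists an infinite subset S′ of S such that the ℚ-vector subspace of ℂ spanned by S′ is finite dimensional. (Main Lemma.) -/

import Mathlib

open Complex Set

noncomputable section

/-- `f` is an exponential polynomial, i.e. an element of the ring `𝓔`. -/
def IsExpPoly (f : ℂ → ℂ) : Prop :=
  ∃ (N : ℕ) (lam mu : Fin N → ℂ),
    ∀ z : ℂ, f z = ∑ i, lam i * Complex.exp (mu i * z)

/-- `h` divides `f` in the ring `𝓔`. -/
def EDvd (h f : ℂ → ℂ) : Prop :=
  ∃ q : ℂ → ℂ, IsExpPoly q ∧ f = h * q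

/-- `f` is a unit of the ring `𝓔`. -/
def EUnit (f : ℂ → ℂ) : Prop :=
  IsExpPoly f ∧ ∃ g : ℂ → ℂ, IsExpPoly g ∧ f * g = 1

/-- `f` is irreducible in the ring `𝓔`. -/
def EIrreducible (f : ℂ → ℂ) : Prop :=
  IsExpPoly f ∧ f ≠ 0 ∧ ¬ EUnit f ∧
    ∀ g h : ℂ → ℂ, IsExpPoly g → IsExpPoly h → f = g * h → EUnit g ∨ EUnit h

/-- canonical representation: pairwise distinct exponents, nonzero coefficients. -/
def IsCanonicalRep (f : ℂ → ℂ) {N : ℕ} (lam mu : Fin N → ℂ) : Prop :=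
  (∀ i, lam i ≠ 0) ∧ Function.Injective mu ∧
    ∀ z : ℂ, f z = ∑ i, lam i * Complex.exp (mu i * z)

/-- `f` is a simple exponential polynomial: its support has `ℚ`-dimension 1. -/
def IsSimple (f : ℂ → ℂ) : Prop :=
  ∃ (N : ℕ) (lam mu : Fin N → ℂ), IsCanonicalRep f lam mu ∧
    Module.finrank ℚ (Submodule.span ℚ (Set.range mu)) = 1

/-- Transcendence degree over `ℚ` of (the field generated by) a set of complex numbers. -/
noncomputable def trdegQ (s : Set ℂ) : Cardinal.{0} :=
  ⨆ t : {t : Finset ℂ // ↑t ⊆ s ∧ AlgebraicIndependent ℚ (Subtype.val : {x : ℂ // x ∈ t} → ℂ)},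
    (t.1.card : Cardinal)

/-- Schanuel's Conjecture. -/
def SchanuelConjecture : Prop :=
  ∀ (n : ℕ) (lam : Fin n → ℂ), LinearIndependent ℚ lam →
    (n : Cardinal) ≤ trdegQ (Set.range lam ∪ Set.range fun i => Complex.exp (lam i))

open Polynomial in
theorem core_ufd {R L : Type*} [CommRing R] [IsDomain R] [UniqueFactorizationMonoid R] [Field L]
    [Algebra R L] (hinj : Function.Injective (algebraMap R L)) (y : L) (F G : R[X])
    (hF0 : F ≠ 0) (hF : aeval y F = 0) (hG : aeval y G = 0) :
    ∃ H : R[X], H ∣ F ∧ H ∣ G ∧ aeval y H = 0 := by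
  classical
  have key : ∃ H : R[X], Irreducible H ∧ H ∣ F ∧ aeval y H = 0 := by
    obtain ⟨s, hs, u, hu⟩ := UniqueFactorizationMonoid.exists_prime_factors F hF0
    have h2 : aeval y s.prod = 0 := by
      have : aeval y s.prod * aeval y (u : R[X]) = 0 := by rw [← map_mul, hu, hF]
      rcases mul_eq_zero.1 this with h | h
      · exact h
      · exact absurd h ((u.isUnit.map (aeval y)).ne_zero)
    rw [map_multiset_prod, Multiset.prod_eq_zero_iff, Multiset.mem_map] at h2
    obtain ⟨H, hHs, hH⟩ := h2
    exact ⟨H, (hs H hHs).irreducible, (Multiset.dvd_prod hHs).trans ⟨u, hu.symm⟩, hH⟩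
  obtain ⟨H, hirr, hHF, hH⟩ := key
  refine ⟨H, hHF, ?_, hH⟩
  by_cases hG0 : G = 0
  · simp [hG0]
  have hdeg : H.natDegree ≠ 0 := by
    intro h
    rw [natDegree_eq_zero] at h
    obtain ⟨r, rfl⟩ := h
    rw [aeval_C] at hH
    have : r = 0 := hinj (by simpa using hH)
    exact hirr.ne_zero (by simp [this])
  have hprim := hirr.isPrimitive hdeg
  let : NormalizedGCDMonoid R := Classical.choice inferInstance
  have : FaithfulSMul R L := (faithfulSMul_iff_algebraMap_injective R L).2 hinj
  let K := FractionRing R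
  let : Algebra K L := FractionRing.liftAlgebra R L
  have : IsScalarTower R K L := inferInstance
  have hirr' := (hprim.irreducible_iff_irreducible_map_fraction_map (K := K)).1 hirr
  have hm : ∀ P : R[X], aeval y P = 0 → minpoly K y ∣ P.map (algebraMap R K) := by
    intro P hP
    apply minpoly.dvd
    rw [aeval_map_algebraMap, hP]
  have hd : H.map (algebraMap R K) ∣ G.map (algebraMap R K) := by
    have := hm H hH
    have h3 : ¬ IsUnit (minpoly K y) := minpoly.not_isUnit K y
    rcases hirr'.dvd_iff.1 this with h | h
    · exact absurd h h3
    · exact h.dvd.trans (hm G hG)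
  exact (hprim.dvd_iff_fraction_map_dvd_fraction_map K).2 hd

open MvPolynomial in
theorem core_option {ι K L : Type*} [Field K] [Field L] [Algebra K L] (x : ι → L)
    (hx : AlgebraicIndependent K x) (y : L) (F G : MvPolynomial (Option ι) K)
    (hF0 : F ≠ 0) (hF : aeval (fun o : Option ι => o.elim y x) F = 0)
    (hG : aeval (fun o : Option ι => o.elim y x) G = 0) :
    ∃ H, H ∣ F ∧ H ∣ G ∧ aeval (fun o : Option ι => o.elim y x) H = 0 := by
  have : UniqueFactorizationMonoid (Algebra.adjoin K (Set.range x)) :=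
    MulEquiv.uniqueFactorizationMonoid hx.aevalEquiv.toMulEquiv inferInstance
  have hc : ∀ P, Polynomial.aeval y (hx.mvPolynomialOptionEquivPolynomialAdjoin P) =
      aeval (fun o : Option ι => o.elim y x) P := fun P =>
    RingHom.congr_fun (hx.aeval_comp_mvPolynomialOptionEquivPolynomialAdjoin y) P
  obtain ⟨H, h1, h2, h3⟩ := core_ufd (R := Algebra.adjoin K (Set.range x)) (L := L)
    Subtype.val_injective y (hx.mvPolynomialOptionEquivPolynomialAdjoin F)
      (hx.mvPolynomialOptionEquivPolynomialAdjoin G) (by rwa [Ne, EmbeddingLike.map_eq_zero_iff])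
      (by rw [hc, hF]) (by rw [hc, hG])
  obtain ⟨H, rfl⟩ := hx.mvPolynomialOptionEquivPolynomialAdjoin.surjective H
  exact ⟨H, (map_dvd_iff _).1 h1, (map_dvd_iff _).1 h2, by rw [← hc, h3]⟩

open MvPolynomial in
theorem core_mv {σ K L : Type*} [Field K] [Field L] [Algebra K L] (x : σ → L) (k : σ)
    (hx : AlgebraicIndependent K (fun i : {i // i ≠ k} => x i)) (F G : MvPolynomial σ K)
    (hF0 : F ≠ 0) (hF : aeval x F = 0) (hG : aeval x G = 0) :
    ∃ H, H ∣ F ∧ H ∣ G ∧ aeval x H = 0 := by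
  classical
  let e := Equiv.optionSubtypeNe k
  have hc : ∀ P, aeval (fun o : Option {i // i ≠ k} => o.elim (x k) (fun i => x i))
      (renameEquiv K e.symm P) = aeval x P := by
    intro P
    rw [renameEquiv_apply, aeval_rename]
    congr 2
    funext i
    by_cases h : i = k
    · subst h; simp [e]
    · simp [e, h]
  obtain ⟨H, h1, h2, h3⟩ := core_option _ hx (x k) (renameEquiv K e.symm F)
    (renameEquiv K e.symm G) (by rwa [Ne, EmbeddingLike.map_eq_zero_iff]) (by rw [hc, hF]) (by rw [hc, hG])
  obtain ⟨H, rfl⟩ := (renameEquiv K e.symm).surjective H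
  exact ⟨H, (map_dvd_iff _).1 h1, (map_dvd_iff _).1 h2, by rw [← hc, h3]⟩

theorem IsExpPoly.of_finset {ι : Type*} (t : Finset ι) (lam mu : ι → ℂ) :
    IsExpPoly (fun z => ∑ i ∈ t, lam i * Complex.exp (mu i * z)) := by
  refine ⟨t.card, fun i => lam (t.equivFin.symm i), fun i => mu (t.equivFin.symm i), fun z => ?_⟩
  beta_reduce
  rw [← Finset.sum_coe_sort t]
  exact (Equiv.sum_comp t.equivFin.symm (fun i : t => lam i * Complex.exp (mu i * z))).symm

theorem IsExpPoly.add {f g : ℂ → ℂ} (hf : IsExpPoly f) (hg : IsExpPoly g) : IsExpPoly (f + g) := by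
  obtain ⟨N, l, m, h⟩ := hf
  obtain ⟨N', l', m', h'⟩ := hg
  have := IsExpPoly.of_finset Finset.univ (Sum.elim l l') (Sum.elim m m')
  convert this using 1
  funext z
  simp [h, h']

theorem IsExpPoly.mul {f g : ℂ → ℂ} (hf : IsExpPoly f) (hg : IsExpPoly g) : IsExpPoly (f * g) := by
  obtain ⟨N, l, m, h⟩ := hf
  obtain ⟨N', l', m', h'⟩ := hg
  have := IsExpPoly.of_finset Finset.univ (fun p : Fin N × Fin N' => l p.1 * l' p.2)
    (fun p => m p.1 + m' p.2)
  convert this using 1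
  funext z
  simp only [Pi.mul_apply, h, h', Fintype.sum_mul_sum, Fintype.sum_prod_type, add_mul, Complex.exp_add]
  refine Finset.sum_congr rfl fun i _ => Finset.sum_congr rfl fun j _ => ?_
  ring

theorem IsExpPoly.single (a b : ℂ) : IsExpPoly (fun z => a * Complex.exp (b * z)) :=
  ⟨1, fun _ => a, fun _ => b, fun z => by simp⟩

theorem IsExpPoly.aeval {σ K : Type*} [Field K] [Algebra K ℂ] (c : σ → ℂ) (P : MvPolynomial σ K) :
    IsExpPoly (fun z => MvPolynomial.aeval (fun k => Complex.exp (c k * z)) P) := by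
  induction P using MvPolynomial.induction_on with
  | C a => simpa using IsExpPoly.single (algebraMap K ℂ a) 0
  | add p q hp hq => simpa [Pi.add_def] using hp.add hq
  | mul_X p i hp =>
    have := hp.mul (IsExpPoly.single 1 (c i))
    simpa [Pi.mul_def] using this

theorem EUnit.inv_mul {q r : ℂ → ℂ} (hq : EUnit q) (hr : EUnit r) {h f g : ℂ → ℂ}
    (hf : f = h * q) (hg : g = h * r) : ∃ u, EUnit u ∧ f = u * g := by
  obtain ⟨hq, q', hq', hqq⟩ := hq
  obtain ⟨hr, r', hr', hrr⟩ := hr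
  refine ⟨q * r', ⟨hq.mul hr', r * q', hr.mul hq', ?_⟩, ?_⟩
  · calc q * r' * (r * q') = (q * q') * (r * r') := by ring
      _ = 1 := by rw [hqq, hrr, one_mul]
  · rw [hf, hg]
    calc h * q = h * q * (r * r') := by rw [hrr, mul_one]
      _ = _ := by ring

theorem EUnit.ne_zero {q : ℂ → ℂ} (hq : EUnit q) (s : ℂ) : q s ≠ 0 := by
  obtain ⟨-, r, -, h⟩ := hq
  have := congrFun h s
  intro h0
  simp [h0] at this

theorem exists_poly {σ K : Type*} [Fintype σ] [Field K] [Algebra K ℂ] {N : ℕ} (n : Fin N → σ → ℤ)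
    (a : Fin N → K) : ∃ (F : MvPolynomial σ K) (m : σ → ℕ),
      (∀ y : σ → ℂ, (∀ k, y k ≠ 0) → MvPolynomial.aeval y F =
        (∏ k, y k ^ m k) * ∑ i, algebraMap K ℂ (a i) * ∏ k, y k ^ n i k) ∧
      (Function.Injective n → (∀ i, a i ≠ 0) → 0 < N → F ≠ 0) := by
  classical
  let m : σ → ℕ := fun k => ∑ i, (n i k).natAbs
  have hm : ∀ i k, 0 ≤ n i k + m k := by
    intro i k
    have : (n i k).natAbs ≤ m k :=
      Finset.single_le_sum (f := fun i => (n i k).natAbs) (fun _ _ => Nat.zero_le _) (Finset.mem_univ i)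
    omega
  let e : Fin N → σ →₀ ℕ := fun i => Finsupp.equivFunOnFinite.symm fun k => (n i k + m k).toNat
  refine ⟨∑ i, MvPolynomial.monomial (e i) (a i), m, ?_, ?_⟩
  · intro y hy
    rw [map_sum, Finset.mul_sum]
    refine Finset.sum_congr rfl fun i _ => ?_
    rw [MvPolynomial.aeval_monomial, mul_left_comm, Finsupp.prod_fintype _ _ (by simp),
      ← Finset.prod_mul_distrib]
    congr 1
    refine Finset.prod_congr rfl fun k _ => ?_
    rw [← zpow_natCast, ← zpow_natCast, ← zpow_add₀ (hy k)]
    congr 1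
    simp only [e, Finsupp.equivFunOnFinite_symm_apply_apply]
    rw [Int.toNat_of_nonneg (hm i k), add_comm]
  · intro hn ha hN h0
    have hinj : Function.Injective e := by
      intro i j hij
      apply hn
      funext k
      have := DFunLike.congr_fun hij k
      simp only [e, Finsupp.equivFunOnFinite_symm_apply_apply] at this
      have h1 := hm i k
      have h2 := hm j k
      omega
    have := congrArg (MvPolynomial.coeff (e ⟨0, hN⟩)) h0
    rw [MvPolynomial.coeff_sum] at this
    simp only [MvPolynomial.coeff_monomial, hinj.eq_iff] at this
    simp at this
    exact ha _ this

theorem exp_zcomb {σ : Type*} [Fintype σ] (c : σ → ℂ) (n : σ → ℤ) (z : ℂ) :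
    Complex.exp ((∑ k, (n k : ℂ) * c k) * z) = ∏ k, Complex.exp (c k * z) ^ n k := by
  rw [Finset.sum_mul, Complex.exp_sum]
  refine Finset.prod_congr rfl fun k _ => ?_
  rw [mul_assoc, Complex.exp_int_mul]

theorem exp_ncomb {σ : Type*} [Fintype σ] (c : σ → ℂ) (n : σ → ℕ) (z : ℂ) :
    Complex.exp ((∑ k, (n k : ℂ) * c k) * z) = ∏ k, Complex.exp (c k * z) ^ n k := by
  simpa using exp_zcomb c (fun k => (n k : ℤ)) z

theorem caseB {σ K : Type*} [Fintype σ] [Field K] [Algebra K ℂ]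
    (f g : ℂ → ℂ) (N M : ℕ) (lam mu : Fin N → ℂ) (l em : Fin M → ℂ)
    (hfrep : IsCanonicalRep f lam mu) (hgrep : IsCanonicalRep g l em)
    (hfirr : EIrreducible f) (hgirr : EIrreducible g)
    (hdist : ¬ ∃ u : ℂ → ℂ, EUnit u ∧ f = u * g)
    (s : ℂ) (hfs : f s = 0) (hgs : g s = 0)
    (hlam : ∀ i, lam i ∈ (algebraMap K ℂ).range) (hl : ∀ i, l i ∈ (algebraMap K ℂ).range)
    (c : σ → ℂ) (hmu : ∀ i, ∃ n : σ → ℤ, mu i = ∑ k, (n k : ℂ) * c k)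
    (hem : ∀ i, ∃ n : σ → ℤ, em i = ∑ k, (n k : ℂ) * c k) (k : σ)
    (hind : AlgebraicIndependent K (fun i : {i // i ≠ k} => Complex.exp (c i * s))) : False := by
  choose a ha using hlam
  choose b hb using hl
  choose n hn using hmu
  choose n' hn' using hem
  obtain ⟨F, m, hF, hF0⟩ := exists_poly n a
  obtain ⟨G, m', hG, -⟩ := exists_poly n' b
  have hF1 : ∀ z, MvPolynomial.aeval (fun k => Complex.exp (c k * z)) F =
      Complex.exp ((∑ k, (m k : ℂ) * c k) * z) * f z := by
    intro z
    rw [hF _ (fun k => Complex.exp_ne_zero _), exp_ncomb, hfrep.2.2 z]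
    simp only [ha, hn, exp_zcomb]
  have hG1 : ∀ z, MvPolynomial.aeval (fun k => Complex.exp (c k * z)) G =
      Complex.exp ((∑ k, (m' k : ℂ) * c k) * z) * g z := by
    intro z
    rw [hG _ (fun k => Complex.exp_ne_zero _), exp_ncomb, hgrep.2.2 z]
    simp only [hb, hn', exp_zcomb]
  have hF0 : F ≠ 0 := by
    rintro rfl
    apply hfirr.2.1
    funext z
    have := hF1 z
    simpa [Complex.exp_ne_zero] using this.symm
  obtain ⟨H, ⟨Q, hQ⟩, ⟨R, hR⟩, hH⟩ := core_mv (fun k => Complex.exp (c k * s)) k hind F G hF0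
    (by rw [hF1, hfs, mul_zero]) (by rw [hG1, hgs, mul_zero])
  have fac : ∀ (f : ℂ → ℂ) (F Q : MvPolynomial σ K) (α : ℂ), EIrreducible f → F = H * Q → 
      (∀ z, MvPolynomial.aeval (fun k => Complex.exp (c k * z)) F = Complex.exp (α * z) * f z) → 
      ∃ q, EUnit q ∧ f = (fun z => MvPolynomial.aeval (fun k => Complex.exp (c k * z)) H) * q := by
    intro f F Q α hf hFQ hF
    let q : ℂ → ℂ := (fun z => MvPolynomial.aeval (fun k => Complex.exp (c k * z)) Q) *
      (fun z => 1 * Complex.exp (-α * z))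
    have hq : IsExpPoly q := (IsExpPoly.aeval c Q).mul (IsExpPoly.single _ _)
    have hfe : f = (fun z => MvPolynomial.aeval (fun k => Complex.exp (c k * z)) H) * q := by
      funext z
      have h1 := hF z
      rw [hFQ, map_mul] at h1
      simp only [q, Pi.mul_apply]
      rw [← mul_assoc, h1, one_mul, mul_comm, ← mul_assoc, ← Complex.exp_add]
      simp
    refine ⟨q, ?_, hfe⟩
    rcases hf.2.2.2 _ q (IsExpPoly.aeval c H) hq hfe with h | h
    · exact absurd hH (h.ne_zero s)
    · exact h
  obtain ⟨q, hq, h1⟩ := fac f F Q _ hfirr hQ hF1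
  obtain ⟨r, hr, h2⟩ := fac g G R _ hgirr hR hG1
  exact hdist (hq.inv_mul hr h1 h2)

theorem caseA {σ K : Type*} [Fintype σ] [Field K] [Algebra K ℂ]
    (N : ℕ) (hN : 0 < N) (lam mu : Fin N → ℂ) (h0 : ∀ i, lam i ≠ 0) (s : ℂ)
    (hfs : ∑ i, lam i * Complex.exp (mu i * s) = 0)
    (hlam : ∀ i, lam i ∈ (algebraMap K ℂ).range) (c : σ → ℂ) (n : Fin N → σ → ℤ)
    (hn : Function.Injective n)
    (hmu : ∀ i, Complex.exp (mu i * s - ∑ k, (n i k : ℂ) * c k * s) ∈ (algebraMap K ℂ).range)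
    (hind : AlgebraicIndependent K (fun i => Complex.exp (c i * s))) : False := by
  have h1 : ∀ i, lam i * Complex.exp (mu i * s - ∑ k, (n i k : ℂ) * c k * s) ∈ (algebraMap K ℂ).range :=
    fun i => mul_mem (hlam i) (hmu i)
  choose a ha using h1
  obtain ⟨F, m, hF, hF0⟩ := exists_poly n a
  refine hF0 hn (fun i h => ?_) hN ?_
  · have := ha i
    rw [h, map_zero] at this
    exact mul_ne_zero (h0 i) (Complex.exp_ne_zero _) this.symm
  · apply hind.eq_zero_of_aeval_eq_zero
    rw [hF _ (fun k => Complex.exp_ne_zero _)]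
    convert mul_zero _
    rw [← hfs]
    refine Finset.sum_congr rfl fun i _ => ?_
    rw [ha, ← exp_zcomb, mul_assoc, ← Complex.exp_add, ← Finset.sum_mul]
    simp

abbrev algM : Matroid ℂ := AlgebraicIndependent.matroid ℚ ℂ

def clo (X : Set ℂ) : IntermediateField ℚ ℂ :=
  (algebraicClosure (IntermediateField.adjoin ℚ X) ℂ).restrictScalars ℚ

theorem mem_clo {X : Set ℂ} {z : ℂ} : z ∈ clo X ↔ z ∈ algM.closure X := by
  unfold clo algM
  rw [AlgebraicIndependent.matroid_closure_eq, IntermediateField.mem_restrictScalars,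
    mem_algebraicClosure_iff, SetLike.mem_coe, Subalgebra.mem_algebraicClosure,
    IntermediateField.isAlgebraic_adjoin_iff]

theorem clo_alg {X : Set ℂ} {z : ℂ} (hz : IsAlgebraic (clo X) z) : z ∈ clo X := by
  unfold clo
  rw [IntermediateField.mem_restrictScalars, mem_algebraicClosure_iff]
  have : IsAlgebraic (algebraicClosure (IntermediateField.adjoin ℚ X) ℂ) z := hz
  exact this.restrictScalars _

theorem subset_clo (X : Set ℂ) : X ⊆ clo X := by
  intro z hz
  rw [SetLike.mem_coe, mem_clo]
  exact algM.mem_closure_of_mem hz (by simp)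

theorem clo_mono {X Y : Set ℂ} (h : X ⊆ Y) : clo X ≤ clo Y := by
  intro z hz
  rw [mem_clo] at *
  exact algM.closure_subset_closure h hz

theorem clo_pow {X : Set ℂ} {z : ℂ} {n : ℕ} (hn : 0 < n) (hz : z ^ n ∈ clo X) : z ∈ clo X := by
  apply clo_alg
  exact IsAlgebraic.of_pow hn (isAlgebraic_algebraMap (⟨z ^ n, hz⟩ : clo X))

theorem exp_span {X E : Set ℂ} (h : ∀ e ∈ E, Complex.exp e ∈ clo X) {z : ℂ}
    (hz : z ∈ Submodule.span ℚ E) : Complex.exp z ∈ clo X := by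
  induction hz using Submodule.span_induction with
  | mem x hx => exact h x hx
  | zero => simp [one_mem]
  | add x y _ _ hx hy => rw [Complex.exp_add]; exact mul_mem hx hy
  | smul a x _ hx =>
    apply clo_pow a.den_pos
    have : Complex.exp (a • x) ^ a.den = Complex.exp x ^ a.num := by
      rw [← Complex.exp_nat_mul, ← Complex.exp_int_mul]
      congr 1
      rw [Rat.smul_def, ← mul_assoc]
      congr 1
      have := Rat.den_mul_eq_num a
      exact_mod_cast this
    rw [this]
    exact zpow_mem hx _

theorem exists_indep (W Y : Set ℂ) (hW : W.Finite) (d : ℕ)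
    (hd : algM.eRk W + d ≤ algM.eRk (W ∪ Y)) :
    ∃ J ⊆ Y, (d : ℕ∞) ≤ J.encard ∧ AlgebraicIndependent (clo W) ((↑) : J → ℂ) := by
  obtain ⟨I, hI⟩ := algM.exists_isBasis W
  obtain ⟨B, hB, hIB⟩ := hI.indep.subset_isBasis_of_subset
    (hI.subset.trans (subset_union_left (t := Y)))
  have hIf : I.Finite := hW.subset hI.subset
  have hBW : B ∩ W = I := hI.inter_eq_of_subset_indep hIB hB.indep
  refine ⟨B \ I, ?_, ?_, ?_⟩
  · rintro z ⟨h1, h2⟩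
    rcases hB.subset h1 with h | h
    · exact absurd (hBW ▸ ⟨h1, h⟩ : z ∈ I) h2
    · exact h
  · rw [hI.eRk_eq_encard, hB.eRk_eq_encard, ← Set.encard_sdiff_add_encard_of_subset hIB, add_comm] at hd
    exact (ENat.add_le_add_iff_right (by simpa using hIf)).1 hd
  · have hcl : clo I = clo W := by
      ext z
      rw [mem_clo, mem_clo, hI.closure_eq_closure]
    rw [← hcl]
    have hBi : AlgebraicIndependent ℚ ((↑) : B → ℂ) := hB.indep
    have h1 := hBi.adjoin_of_disjoint (s := {b : B | (b : ℂ) ∈ I}) (t := {b : B | (b : ℂ) ∉ I})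
      (by rw [Set.disjoint_left]; intro a h1 h2; exact h2 h1)
    have himg : ((↑) : B → ℂ) '' {b : B | (b : ℂ) ∈ I} = I := by
      ext z; constructor
      · rintro ⟨b, hb, rfl⟩; exact hb
      · intro hz; exact ⟨⟨z, hIB hz⟩, hz, rfl⟩
    rw [himg] at h1
    have h2 := IntermediateField.algebraicIndependent_adjoin_iff.2 h1
    have h3 := h2.algebraicClosure
    have h4 := h3.comp (fun j : (B \ I : Set ℂ) => (⟨⟨j.1, j.2.1⟩, j.2.2⟩ : {b : B | (b : ℂ) ∉ I}))
      (by intro a b hab; simpa [Subtype.ext_iff] using hab)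
    exact h4

theorem trdegQ_le {X : Set ℂ} (hX : X.Finite) {n : ℕ} (h : (n : Cardinal) ≤ trdegQ X) :
    (n : ℕ∞) ≤ algM.eRk X := by
  have hf : algM.eRk X ≠ ⊤ := ((algM.eRk_le_encard X).trans_lt (by simpa using hX)).ne
  obtain ⟨r, hr⟩ := ENat.ne_top_iff_exists.1 hf
  rw [← hr]
  have : trdegQ X ≤ r := by
    apply ciSup_le'
    rintro ⟨t, ht, hti⟩
    have h1 : algM.Indep (t : Set ℂ) := hti
    have := h1.encard_le_eRk_of_subset ht
    rw [← hr, Set.encard_coe_eq_coe_finsetCard] at this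
    exact_mod_cast this
  exact_mod_cast h.trans this

theorem exists_lin (L : Submodule ℚ ℂ) (A : Set ℂ) (hA : A.Finite) (s : ℂ) :
    ∃ (d : ℕ) (c : Fin d → ℂ), (∀ k, c k ∈ Submodule.span ℤ A) ∧
      LinearIndependent ℚ (fun k => L.mkQ (c k * s)) ∧
      ∀ a ∈ A, ∃ n : Fin d → ℤ, a * s - ∑ k, (n k : ℂ) * c k * s ∈ L := by
  let φ : ℂ →ₗ[ℤ] (ℂ ⧸ L) :=
    ((L.mkQ : ℂ →+ (ℂ ⧸ L)).comp (AddMonoidHom.mulRight s)).toIntLinearMap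
  have hφ : ∀ a, φ a = L.mkQ (a * s) := fun a => rfl
  let I := (Submodule.span ℤ A).map φ
  have : Module.Finite ℤ I := Module.Finite.iff_fg.2 ((Submodule.fg_span hA).map φ)
  have : IsAddTorsionFree (ℂ ⧸ L) := .of_module_rat _
  have : Module.IsTorsionFree ℤ (ℂ ⧸ L) := inferInstance
  have : Module.IsTorsionFree ℤ I := inferInstance
  have : Module.Free ℤ I := inferInstance
  let b := Module.finBasis ℤ I
  have hb : ∀ k, ∃ c ∈ Submodule.span ℤ A, φ c = b k := fun k => (b k).2
  choose c hc hcb using hb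
  refine ⟨_, c, hc, ?_, ?_⟩
  · rw [← LinearIndependent.iff_fractionRing ℤ ℚ]
    have h1 := b.linearIndependent.map' I.subtype (by simp)
    have h2 : (fun k => L.mkQ (c k * s)) = I.subtype ∘ b := by
      funext k
      exact hcb k
    rw [h2]
    exact h1
  · intro a ha
    have haI : φ a ∈ I := Submodule.mem_map_of_mem (Submodule.subset_span ha)
    refine ⟨fun k => b.repr ⟨φ a, haI⟩ k, ?_⟩
    have h1 := congrArg I.subtype (b.sum_repr ⟨φ a, haI⟩)
    rw [map_sum] at h1
    simp only [map_smul, Submodule.subtype_apply, ← hcb] at h1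
    rw [← Submodule.Quotient.mk_eq_zero, ← Submodule.mkQ_apply, map_sub, sub_eq_zero, ← hφ]
    refine h1.symm.trans ?_
    rw [map_sum]
    refine Finset.sum_congr rfl fun k _ => ?_
    rw [mul_assoc, ← zsmul_eq_mul, map_zsmul]
    rfl

theorem finrank_step (L L' : Submodule ℚ ℂ) [FiniteDimensional ℚ L'] (h : L ≤ L') (d : ℕ)
    (v : Fin d → ℂ) (hv : ∀ k, v k ∈ L') (hli : LinearIndependent ℚ (fun k => L.mkQ (v k))) :
    Module.finrank ℚ L + d ≤ Module.finrank ℚ L' := by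
  have : FiniteDimensional ℚ L := Submodule.finiteDimensional_of_le h
  let b := Module.finBasis ℚ L
  have h1 : LinearIndependent ℚ (Sum.elim (L.subtype ∘ b) v) := by
    exact LinearIndependent.sumElim_of_quotient b.linearIndependent v hli
  have h3 : LinearIndependent ℚ (fun i => (⟨Sum.elim (L.subtype ∘ b) v i, by
      rcases i with i | i
      · exact h (b i).2
      · exact hv i⟩ : L')) := LinearIndependent.of_comp L'.subtype h1
  simpa using h3.fintype_card_le_finrank

theorem exists_idx {d : ℕ} (x : Fin d → ℂ) (J : Set ℂ) (hJ : J ⊆ Set.range x) :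
    ∃ U : Set (Fin d), U.encard = J.encard ∧ Set.InjOn x U ∧ ∀ i ∈ U, x i ∈ J := by
  obtain ⟨U, -, hU⟩ := Set.SurjOn.exists_bijOn_subset (s := Set.univ) (f := x) (t := J)
    (by intro z hz; simpa using hJ hz)
  exact ⟨U, by rw [← hU.image_eq, hU.injOn.encard_image], hU.injOn, fun i hi => hU.mapsTo hi⟩

def PP (A : Set ℂ) (T : Finset ℂ) : Set ℂ := Set.image2 (· * ·) A T

def LL (A : Set ℂ) (T : Finset ℂ) : Submodule ℚ ℂ := Submodule.span ℚ (PP A T)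

def WW (A C : Set ℂ) (T : Finset ℂ) : Set ℂ :=
  A ∪ C ∪ T ∪ PP A T ∪ Complex.exp '' PP A T

theorem PP_finite {A : Set ℂ} (hA : A.Finite) (T : Finset ℂ) : (PP A T).Finite :=
  hA.image2 _ T.finite_toSet

theorem WW_finite {A C : Set ℂ} (hA : A.Finite) (hC : C.Finite) (T : Finset ℂ) :
    (WW A C T).Finite :=
  (((hA.union hC).union T.finite_toSet).union (PP_finite hA T)).union ((PP_finite hA T).image _)

theorem SC_bound (hSC : SchanuelConjecture) {A C : Set ℂ} (hA : A.Finite) (T : Finset ℂ) :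
    (Module.finrank ℚ (LL A T) : ℕ∞) ≤ algM.eRk (WW A C T) := by
  obtain ⟨b, hb, hsp, hli⟩ := exists_linearIndependent ℚ (PP A T)
  have hbf : b.Finite := (PP_finite hA T).subset hb
  have : Fintype b := hbf.fintype
  have hcard : Module.finrank ℚ (LL A T) = Fintype.card b := by
    rw [LL, ← hsp]
    have := finrank_span_eq_card hli
    rwa [Subtype.range_coe] at this
  let e := Fintype.equivFin b
  have h1 := hSC _ (fun i => ((e.symm i : b) : ℂ)) (hli.comp _ e.symm.injective)
  have h2 := trdegQ_le (((Set.finite_range _).union (Set.finite_range _))) h1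
  rw [hcard]
  refine h2.trans (algM.eRk_mono ?_)
  rintro z (⟨i, rfl⟩ | ⟨i, rfl⟩)
  · exact Or.inl (Or.inr (hb (e.symm i).2))
  · exact Or.inr ⟨_, hb (e.symm i).2, rfl⟩

theorem exists_min (hSC : SchanuelConjecture) {A C : Set ℂ} (hA : A.Finite) (hC : C.Finite)
    (S : Set ℂ) : ∃ T : Finset ℂ, ∀ s ∈ S, ∀ d : ℕ,
      Module.finrank ℚ (LL A T) + d ≤ Module.finrank ℚ (LL A (insert s T)) →
      algM.eRk (WW A C T) + d ≤ algM.eRk (WW A C (insert s T)) := by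
  have hr : ∀ T, ∃ r : ℕ, algM.eRk (WW A C T) = r := fun T => by
    have hf : algM.eRk (WW A C T) ≠ ⊤ :=
      ((algM.eRk_le_encard _).trans_lt (by simpa using WW_finite hA hC T)).ne
    obtain ⟨r, hr⟩ := ENat.ne_top_iff_exists.1 hf
    exact ⟨r, hr.symm⟩
  choose r hr using hr
  have hb : ∀ T, Module.finrank ℚ (LL A T) ≤ r T := fun T => by
    have := SC_bound hSC (C := C) hA T
    rw [hr] at this
    exact_mod_cast this
  let δ : Finset ℂ → ℕ := fun T => r T - Module.finrank ℚ (LL A T)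
  refine ⟨Function.argmin δ, fun s _ d hd => ?_⟩
  have h1 : δ (Function.argmin δ) ≤ δ (insert s (Function.argmin δ)) := Function.argmin_le δ _
  generalize Function.argmin δ = T at *
  have h2 := hb T
  have h3 := hb (insert s T)
  simp only [δ] at h1
  rw [hr, hr]
  norm_cast
  omega

theorem step (f g : ℂ → ℂ) (N M : ℕ) (lam mu : Fin N → ℂ) (l em : Fin M → ℂ)
    (hfrep : IsCanonicalRep f lam mu) (hgrep : IsCanonicalRep g l em)
    (hfirr : EIrreducible f) (hgirr : EIrreducible g)
    (hdist : ¬ ∃ u : ℂ → ℂ, EUnit u ∧ f = u * g)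
    (A C : Set ℂ) (hAdef : A = Set.range mu ∪ Set.range em) (hCdef : C = Set.range lam ∪ Set.range l)
    (s : ℂ) (hfs : f s = 0) (hgs : g s = 0) (T : Finset ℂ)
    (hT : ∀ d : ℕ,
      Module.finrank ℚ (LL A T) + d ≤ Module.finrank ℚ (LL A (insert s T)) →
      algM.eRk (WW A C T) + d ≤ algM.eRk (WW A C (insert s T))) :
    ∃ i j, i ≠ j ∧ (mu i - mu j) * s ∈ LL A T := by
  by_contra! hcon
  have hA : A.Finite := hAdef ▸ (Set.finite_range _).union (Set.finite_range _)
  have hC : C.Finite := hCdef ▸ (Set.finite_range _).union (Set.finite_range _)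
  obtain ⟨d, c, hc, hcli, hcA⟩ := exists_lin (LL A T) A hA s
  -- membership facts
  have hLexp : ∀ X, WW A C T ⊆ X → ∀ z ∈ LL A T, Complex.exp z ∈ clo X := by
    intro X hX z hz
    exact exp_span (E := PP A T) (fun e he => subset_clo X (hX (Or.inr ⟨e, he, rfl⟩))) hz
  have hLK : ∀ z ∈ LL A T, z ∈ clo (WW A C T) := by
    intro z hz
    have : Submodule.span ℚ (PP A T) ≤ Subalgebra.toSubmodule (clo (WW A C T)).toSubalgebra := by
      rw [Submodule.span_le]
      intro e he
      exact subset_clo _ (Or.inl (Or.inr he))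
    exact this hz
  have hAK : ∀ z ∈ Submodule.span ℤ A, z ∈ clo (WW A C T) := by
    intro z hz
    induction hz using Submodule.span_induction with
    | mem x hx => exact subset_clo _ (Or.inl (Or.inl (Or.inl (Or.inl hx))))
    | zero => exact zero_mem _
    | add x y _ _ hx hy => exact add_mem hx hy
    | smul a x _ hx => exact zsmul_mem hx a
  have hCK : ∀ z ∈ C, z ∈ (algebraMap (clo (WW A C T)) ℂ).range := fun z hz =>
    ⟨⟨z, subset_clo _ (Or.inl (Or.inl (Or.inl (Or.inr hz))))⟩, rfl⟩
  have hlam : ∀ i, lam i ∈ (algebraMap (clo (WW A C T)) ℂ).range := fun i =>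
    hCK _ (hCdef ▸ Or.inl ⟨i, rfl⟩)
  have hl : ∀ i, l i ∈ (algebraMap (clo (WW A C T)) ℂ).range := fun i =>
    hCK _ (hCdef ▸ Or.inr ⟨i, rfl⟩)
  have hmuA : ∀ i, mu i ∈ A := fun i => hAdef ▸ Or.inl ⟨i, rfl⟩
  have hemA : ∀ i, em i ∈ A := fun i => hAdef ▸ Or.inr ⟨i, rfl⟩
  -- dimension step
  have hfd : FiniteDimensional ℚ (LL A (insert s T)) :=
    FiniteDimensional.span_of_finite ℚ (PP_finite hA _)
  have hle : LL A T ≤ LL A (insert s T) :=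
    Submodule.span_mono (Set.image2_subset_left (by simp))
  have hdim := finrank_step (LL A T) (LL A (insert s T)) hle d (fun k => c k * s) (by
    intro k
    have : ∀ z ∈ Submodule.span ℤ A, z * s ∈ LL A (insert s T) := by
      intro z hz
      induction hz using Submodule.span_induction with
      | mem x hx => exact Submodule.subset_span ⟨x, hx, s, by simp, rfl⟩
      | zero => simp
      | add x y _ _ hx hy => rw [add_mul]; exact add_mem hx hy
      | smul a x _ hx => rw [smul_mul_assoc]; exact zsmul_mem hx a
    exact this _ (hc k)) hcli
  have hrk := hT d hdim
  set W := WW A C T with hW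
  let x : Fin d → ℂ := fun k => Complex.exp (c k * s)
  let Y : Set ℂ := insert s (Set.range x)
  have hsub : WW A C (insert s T) ⊆ algM.closure (W ∪ Y) := by
    have hsY : s ∈ clo (W ∪ Y) := subset_clo _ (Or.inr (Or.inl rfl))
    have hbase : ∀ z ∈ W, z ∈ clo (W ∪ Y) := fun z hz => subset_clo _ (Or.inl hz)
    intro z hz
    rw [← mem_clo]
    rcases hz with (((hz | hz) | hz) | hz) | hz
    · exact hbase _ (Or.inl (Or.inl (Or.inl (Or.inl hz))))
    · exact hbase _ (Or.inl (Or.inl (Or.inl (Or.inr hz))))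
    · simp only [Finset.coe_insert, Set.mem_insert_iff] at hz
      rcases hz with rfl | hz
      · exact hsY
      · exact hbase _ (Or.inl (Or.inl (Or.inr hz)))
    · obtain ⟨a, ha, t, ht, rfl⟩ := hz
      simp only [Finset.coe_insert, Set.mem_insert_iff] at ht
      rcases ht with rfl | ht
      · exact mul_mem (hbase _ (Or.inl (Or.inl (Or.inl (Or.inl ha))))) hsY
      · exact hbase _ (Or.inl (Or.inr ⟨a, ha, t, ht, rfl⟩))
    · obtain ⟨_, ⟨a, ha, t, ht, rfl⟩, rfl⟩ := hz
      simp only [Finset.coe_insert, Set.mem_insert_iff] at ht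
      rcases ht with rfl | ht
      · obtain ⟨n, hn⟩ := hcA a ha
        have h1 := hLexp (W ∪ Y) Set.subset_union_left _ hn
        have h2 : Complex.exp (a * t) =
            Complex.exp (a * t - ∑ k, (n k : ℂ) * c k * t) * ∏ k, x k ^ n k := by
          rw [← exp_zcomb, ← Complex.exp_add, ← Finset.sum_mul]
          simp
        change Complex.exp (a * t) ∈ _
        rw [h2]
        exact mul_mem h1 (prod_mem fun k _ => zpow_mem (subset_clo _ (Or.inr (Or.inr ⟨k, rfl⟩))) _)
      · exact hbase _ (Or.inr ⟨_, ⟨a, ha, t, ht, rfl⟩, rfl⟩)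
  have hrk2 : algM.eRk W + d ≤ algM.eRk (W ∪ Y) := by
    refine hrk.trans ((algM.eRk_mono hsub).trans ?_)
    rw [Matroid.eRk_closure_eq]
  obtain ⟨J, hJY, hJd, hJ⟩ := exists_indep W Y (WW_finite hA hC T) d hrk2
  -- case A
  have hNpos : 0 < N := by
    rcases Nat.eq_zero_or_pos N with rfl | h
    · exact absurd (funext fun z => by simpa using hfrep.2.2 z) hfirr.2.1
    · exact h
  have hA' : ¬ AlgebraicIndependent (clo W) x := by
    intro hind
    choose n hn using fun i => hcA (mu i) (hmuA i)
    refine caseA (K := clo W) N hNpos lam mu hfrep.1 s (by rw [← hfrep.2.2, hfs]) hlam c n ?_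
      (fun i => ⟨⟨_, hLexp W subset_rfl _ (hn i)⟩, rfl⟩) hind
    intro i j hij
    by_contra hne
    apply hcon i j hne
    have := sub_mem (hn i) (hn j)
    rw [hij] at this
    convert this using 1
    ring
  -- indices
  have hJ1 : J \ {s} ⊆ Set.range x := by
    rintro z ⟨h1, h2⟩
    rcases hJY h1 with h | h
    · exact absurd h h2
    · exact h
  obtain ⟨U, hU1, hU2, hU3⟩ := exists_idx x (J \ {s}) hJ1
  have hUind : ∀ (ι : Type) (e : ι → Fin d), Function.Injective e → (∀ i, e i ∈ U) →
      AlgebraicIndependent (clo W) (x ∘ e) := by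
    intro ι e he heU
    exact hJ.comp (fun i => (⟨x (e i), (hU3 _ (heU i)).1⟩ : J)) (by
      intro i j hij
      exact he (hU2 (heU i) (heU j) (by simpa using hij)))
  have hUne : U ≠ Set.univ := by
    intro h
    exact hA' (hUind (Fin d) id Function.injective_id (by simp [h]))
  have hUlt : U.encard < d := by
    have h1 := (Set.toFinite U).encard_lt_encard (Set.ssubset_univ_iff.2 hUne)
    simpa using h1
  have hsJ : s ∈ J := by
    by_contra h
    rw [Set.sdiff_singleton_eq_self h] at hU1
    exact absurd hJd (by rw [← hU1]; exact not_le.2 hUlt)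
  have hsK : s ∉ clo W := by
    intro h
    have := hJ.transcendental ⟨s, hsJ⟩
    exact this (isAlgebraic_algebraMap (⟨s, h⟩ : clo W))
  have hUk : ∃ k, ∀ i, i ≠ k → i ∈ U := by
    obtain ⟨k, hk⟩ := (Set.ne_univ_iff_exists_notMem U).1 hUne
    refine ⟨k, fun i hik => ?_⟩
    by_contra hi
    have h1 : (insert k (insert i U)).encard ≤ d := by
      simpa using Set.encard_le_encard (Set.subset_univ (insert k (insert i U)))
    rw [Set.encard_insert_of_notMem (by simp [hk, hik.symm]), Set.encard_insert_of_notMem hi, hU1,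
      Set.encard_sdiff_singleton_add_one hsJ] at h1
    have h2 := (add_le_add_left hJd 1).trans h1
    norm_cast at h2
    omega
  obtain ⟨k, hk⟩ := hUk
  have hexact : ∀ a ∈ A, ∃ n : Fin d → ℤ, a = ∑ k, (n k : ℂ) * c k := by
    intro a ha
    obtain ⟨n, hn⟩ := hcA a ha
    refine ⟨n, ?_⟩
    by_contra hne
    rw [← Finset.sum_mul, ← sub_mul] at hn
    have h1 : a - ∑ k, (n k : ℂ) * c k ∈ clo W := by
      apply hAK
      refine sub_mem (Submodule.subset_span ha) (sum_mem fun k _ => ?_)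
      rw [← zsmul_eq_mul]
      exact Submodule.smul_mem _ _ (hc k)
    apply hsK
    have h2 := mul_mem (inv_mem h1) (hLK _ hn)
    rwa [inv_mul_cancel_left₀ (sub_ne_zero.2 hne)] at h2
  exact caseB (K := clo W) f g N M lam mu l em hfrep hgrep hfirr hgirr hdist s hfs hgs hlam hl c
    (fun i => hexact _ (hmuA i)) (fun i => hexact _ (hemA i)) k
    (hUind {i // i ≠ k} Subtype.val Subtype.val_injective (fun i => hk i.1 i.2))

/-- **Main Lemma** (assuming Schanuel's Conjecture): some infinite subset of `S` spans a
finite dimensional `ℚ`-vector space. -/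
theorem main_lemma (hSC : SchanuelConjecture)
    (f g : ℂ → ℂ) (N M : ℕ) (lam mu : Fin N → ℂ) (l em : Fin M → ℂ)
    (hfrep : IsCanonicalRep f lam mu) (hgrep : IsCanonicalRep g l em)
    (hfirr : EIrreducible f) (hgirr : EIrreducible g)
    (hdist : ¬ ∃ u : ℂ → ℂ, EUnit u ∧ f = u * g)
    (S : Set ℂ) (hSinf : S.Infinite)
    (hS : ∀ s ∈ S, s ≠ 0 ∧ f s = 0 ∧ g s = 0)
 :
    ∃ S' ⊆ S, S'.Infinite ∧ FiniteDimensional ℚ (Submodule.span ℚ S') := by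
  obtain ⟨T, hT⟩ := exists_min hSC (A := Set.range mu ∪ Set.range em)
    (C := Set.range lam ∪ Set.range l) ((Set.finite_range _).union (Set.finite_range _))
    ((Set.finite_range _).union (Set.finite_range _)) S
  have hstep : ∀ s ∈ S, ∃ p : Fin N × Fin N, p.1 ≠ p.2 ∧
      (mu p.1 - mu p.2) * s ∈ LL (Set.range mu ∪ Set.range em) T := by
    intro s hs
    obtain ⟨i, j, h⟩ := step f g N M lam mu l em hfrep hgrep hfirr hgirr hdist _ _ rfl rfl s
      (hS s hs).2.1 (hS s hs).2.2 T (hT s hs)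
    exact ⟨(i, j), h⟩
  generalize hL : LL (Set.range mu ∪ Set.range em) T = L at hstep
  have hLfd : FiniteDimensional ℚ L := by
    rw [← hL]
    exact FiniteDimensional.span_of_finite ℚ
      (PP_finite ((Set.finite_range _).union (Set.finite_range _)) _)
  have hex : ∃ p : Fin N × Fin N,
      {s | s ∈ S ∧ p.1 ≠ p.2 ∧ (mu p.1 - mu p.2) * s ∈ L}.Infinite := by
    by_contra! hcon
    apply hSinf
    refine (Set.finite_iUnion hcon).subset fun s hs => ?_
    obtain ⟨p, hp⟩ := hstep s hs
    exact Set.mem_iUnion.2 ⟨p, hs, hp⟩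
  obtain ⟨p, hp⟩ := hex
  refine ⟨_, fun s hs => hs.1, hp, ?_⟩
  have hne : mu p.1 - mu p.2 ≠ 0 := by
    obtain ⟨s, hs⟩ := hp.nonempty
    exact sub_ne_zero.2 fun h => hs.2.1 (hfrep.2.1 h)
  have hle : Submodule.span ℚ {s | s ∈ S ∧ p.1 ≠ p.2 ∧ (mu p.1 - mu p.2) * s ∈ L} ≤
      L.map (LinearMap.mulLeft ℚ (mu p.1 - mu p.2)⁻¹) := by
    rw [Submodule.span_le]
    intro s hs
    exact ⟨_, hs.2.2, by simp [inv_mul_cancel_left₀ hne]⟩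
  exact Submodule.finiteDimensional_of_le hle
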